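/- Let V be a vertex algebra, W a quasi V-module, and u, v ∈ V. If h(x₁,x₂) ∈ ℂ((x₁,x₂)) is a formal series such that h(x₁,x₂) Y_W(u,x₁) Y_W(v,x₂) ∈ Hom(W, W((x₁,x₂))), then h(x₂+x₀, x₂) Y_W(Y(u,x₀)v, x₂) = (h(x₁,x₂) Y_W(u,x₁) Y_W(v,x₂))|_{x₁ = x₂+x₀}. -/

import Mathlib

noncomputable section

open scoped BigOperators

/-- The generalized binomial coefficient `C(m, j)` for `m : ℤ`, as a complex number. -/
def zchoose (m : ℤ) (j : ℕ) : ℂ :=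
  (∏ t ∈ Finset.range j, ((m : ℂ) - (t : ℂ))) / (Nat.factorial j : ℂ)

/-- A doubly indexed family of coefficients is "in `M((x₁,x₂))`" if it is lower
truncated in both variables. -/
def LowerTrunc2 {M : Type*} [Zero M] (c : ℤ → ℤ → M) : Prop :=
  ∃ B : ℤ, ∀ m n : ℤ, m < B ∨ n < B → c m n = 0

/-- A vertex algebra over ℂ, given by the coefficient operators `Y u v n = u_n v`
(the coefficient of `x^{-n-1}` in `Y(u,x)v`), with the Borcherds identity. -/
structure VertexAlg (V : Type*) [AddCommGroup V] [Module ℂ V] where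
  Y : V → V → ℤ → V
  vac : V
  add_left : ∀ u u' v : V, ∀ n : ℤ, Y (u + u') v n = Y u v n + Y u' v n
  smul_left : ∀ (t : ℂ) (u v : V) (n : ℤ), Y (t • u) v n = t • Y u v n
  add_right : ∀ u v v' : V, ∀ n : ℤ, Y u (v + v') n = Y u v n + Y u v' n
  smul_right : ∀ (t : ℂ) (u v : V) (n : ℤ), Y u (t • v) n = t • Y u v n
  trunc : ∀ u v : V, ∃ N : ℤ, ∀ n : ℤ, N ≤ n → Y u v n = 0
  vac_left : ∀ (v : V) (n : ℤ), Y vac v n = if n = -1 then v else 0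
  vac_right_create : ∀ v : V, Y v vac (-1) = v
  vac_right_trunc : ∀ (v : V) (n : ℤ), 0 ≤ n → Y v vac n = 0
  borcherds : ∀ u v w : V, ∀ m n k : ℤ,
    (∑ᶠ j : ℕ, zchoose m j • Y (Y u v (n + (j : ℤ))) w (m + k - (j : ℤ))) =
      (∑ᶠ j : ℕ, ((-1 : ℂ) ^ j * zchoose n j) •
        Y u (Y v w (k + (j : ℤ))) (m + n - (j : ℤ))) -
      (∑ᶠ j : ℕ, ((-1 : ℂ) ^ (n + (j : ℤ)) * zchoose n j) •
        Y v (Y u w (m + (j : ℤ))) (n + k - (j : ℤ)))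

/-- Multiply a double series with scalar coefficients `hc` (the coefficient of
`x₁^m x₂^n` being `hc m n`) by a double series with coefficients in a module. -/
def seriesMul {M : Type*} [AddCommGroup M] [Module ℂ M] (hc : ℤ → ℤ → ℂ)
    (F : ℤ → ℤ → M) : ℤ → ℤ → M :=
  fun m n => ∑ᶠ p : ℤ × ℤ, hc p.1 p.2 • F (m - p.1) (n - p.2)

/-- The substitution `x₁ = x₂ + x₀` in a double series `d(x₁,x₂)` (expanding
`x₁^m = ∑_{i≥0} C(m,i) x₀^i x₂^{m-i}`): the result is the coefficient of
`x₀^i x₂^s`. -/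
def substSeries {M : Type*} [AddCommGroup M] [Module ℂ M] (d : ℤ → ℤ → M) :
    ℤ → ℤ → M :=
  fun i s => if 0 ≤ i then ∑ᶠ m : ℤ, zchoose m i.toNat • d m (s - m + i) else 0

/-- The substitution `x₁ = x₂ + x₀` in a scalar double series. -/
def substScalar (hc : ℤ → ℤ → ℂ) : ℤ → ℤ → ℂ :=
  fun i s => if 0 ≤ i then ∑ᶠ m : ℤ, zchoose m i.toNat * hc m (s - m + i) else 0

/-- A quasi module for a vertex algebra, in the weak-associativity formulation:
for each pair `u,v` there is a nonzero polynomial `q(x₁,x₂)` (given by its finitely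
many coefficients `qc`, supported on nonnegative exponents) such that
`q(x₁,x₂) Y_W(u,x₁) Y_W(v,x₂) ∈ Hom(W, W((x₁,x₂)))` and
`q(x₂+x₀,x₂) Y_W(Y(u,x₀)v,x₂) = (q(x₁,x₂) Y_W(u,x₁) Y_W(v,x₂))|_{x₁ = x₂+x₀}`.
Here `YW v w n` is the coefficient of `x^{-n-1}` in `Y_W(v,x)w`. -/
structure QuasiMod {V : Type*} [AddCommGroup V] [Module ℂ V] (VA : VertexAlg V)
    (W : Type*) [AddCommGroup W] [Module ℂ W] where
  YW : V → W → ℤ → W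
  add_left : ∀ u v : V, ∀ w : W, ∀ n : ℤ, YW (u + v) w n = YW u w n + YW v w n
  smul_left : ∀ (t : ℂ) (v : V) (w : W) (n : ℤ), YW (t • v) w n = t • YW v w n
  add_right : ∀ v : V, ∀ w w' : W, ∀ n : ℤ, YW v (w + w') n = YW v w n + YW v w' n
  smul_right : ∀ (t : ℂ) (v : V) (w : W) (n : ℤ), YW v (t • w) n = t • YW v w n
  trunc : ∀ (v : V) (w : W), ∃ N : ℤ, ∀ n : ℤ, N ≤ n → YW v w n = 0
  vac_id : ∀ (w : W) (n : ℤ), YW VA.vac w n = if n = -1 then w else 0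
  weak_assoc : ∀ u v : V, ∃ qc : ℤ × ℤ →₀ ℂ, qc ≠ 0 ∧
    (∀ p ∈ qc.support, 0 ≤ p.1 ∧ 0 ≤ p.2) ∧
    (∀ w : W, LowerTrunc2
      (seriesMul (fun m n => qc (m, n))
        (fun m n => YW u (YW v w (-n - 1)) (-m - 1)))) ∧
    (∀ w : W, ∀ a b : ℤ,
      (∑ᶠ i : ℤ, ∑ᶠ s : ℤ, substScalar (fun m n => qc (m, n)) i s •
          YW (VA.Y u v (-(a - i) - 1)) w (-(b - s) - 1)) =
        substSeries
          (seriesMul (fun m n => qc (m, n))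
            (fun m n => YW u (YW v w (-n - 1)) (-m - 1))) a b)

/-- The family `c` of coefficients is lower truncated in the first index and, for each value of
the first index, lower truncated in the second one: `c` lies in `M((x₂))((x₁))`. -/
def LexTrunc {M : Type*} [Zero M] (c : ℤ → ℤ → M) : Prop :=
  (∃ A : ℤ, ∀ a < A, ∀ b, c a b = 0) ∧ ∀ a, ∃ B : ℤ, ∀ b < B, c a b = 0

/-- The binomial coefficient `zchoose` with an integral lower index. -/
def intChoose (m i : ℤ) : ℂ := if 0 ≤ i then zchoose m i.toNat else 0

section Choose

theorem descPochhammer_smeval_eq_prod_range (z : ℂ) (j : ℕ) :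
    (descPochhammer ℤ j).smeval z = ∏ t ∈ Finset.range j, (z - t) := by
  induction j with
  | zero => simp
  | succ j ih =>
    rw [Finset.prod_range_succ, ← ih]
    simp [descPochhammer_succ_right, Polynomial.smeval_mul, Polynomial.smeval_natCast]

theorem zchoose_eq_choose (m : ℤ) (j : ℕ) : zchoose m j = Ring.choose (m : ℂ) j := by
  rw [zchoose, ← descPochhammer_smeval_eq_prod_range,
    Ring.descPochhammer_eq_factorial_smul_choose, nsmul_eq_mul,
    mul_div_cancel_left₀ _ (Nat.cast_ne_zero.mpr (Nat.factorial_ne_zero j))]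

theorem intChoose_of_neg {m i : ℤ} (hi : i < 0) : intChoose m i = 0 := by
  simp [intChoose, not_le.mpr hi]

theorem nonneg_of_intChoose_ne_zero {m i : ℤ} (h : intChoose m i ≠ 0) : 0 ≤ i := by
  by_contra! hi
  exact h (intChoose_of_neg hi)

theorem intChoose_self {m : ℤ} (hm : 0 ≤ m) : intChoose m m = 1 := by
  lift m to ℕ using hm
  rw [intChoose, if_pos (by positivity), zchoose_eq_choose]
  simp [Ring.choose_natCast]

theorem intChoose_of_lt {m i : ℤ} (hm : 0 ≤ m) (hi : m < i) : intChoose m i = 0 := by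
  lift m to ℕ using hm
  lift i to ℕ using by omega
  rw [intChoose, if_pos (by positivity), zchoose_eq_choose]
  simp [Ring.choose_natCast, Nat.choose_eq_zero_of_lt (Nat.cast_lt.mp hi)]

/-- The Chu–Vandermonde identity. -/
theorem intChoose_add (m n a : ℤ) :
    intChoose (m + n) a = ∑ᶠ i : ℤ, intChoose m i * intChoose n (a - i) := by
  rcases lt_or_ge a 0 with ha | ha
  · rw [intChoose_of_neg ha, finsum_eq_zero_of_forall_eq_zero]
    intro i
    rcases lt_or_ge i 0 with hi | hi
    · rw [intChoose_of_neg hi, zero_mul]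
    · rw [intChoose_of_neg (show a - i < 0 by omega), mul_zero]
  lift a to ℕ using ha
  have hsub : (Function.support fun i : ℤ => intChoose m i * intChoose n (a - i)) ⊆
      ((Finset.range (a + 1)).map Nat.castEmbedding : Finset ℤ) := by
    intro i hi
    have h1 := nonneg_of_intChoose_ne_zero (left_ne_zero_of_mul hi)
    have h2 := nonneg_of_intChoose_ne_zero (right_ne_zero_of_mul hi)
    simp only [Finset.coe_map, Set.mem_image, Finset.mem_coe, Finset.mem_range]
    exact ⟨i.toNat, by omega, by simp [h1]⟩
  rw [finsum_eq_sum_of_support_subset _ hsub, Finset.sum_map, intChoose,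
    if_pos (by positivity), zchoose_eq_choose, Int.toNat_natCast, Int.cast_add,
    Ring.add_choose_eq _ (Commute.all _ _), Finset.Nat.sum_antidiagonal_eq_sum_range_succ_mk]
  refine Finset.sum_congr rfl fun i hi => ?_
  have hi' : i ≤ a := by simpa [Nat.lt_succ_iff] using hi
  simp only [Nat.castEmbedding_apply, ← Nat.cast_sub hi', intChoose, Nat.cast_nonneg, if_true,
    zchoose_eq_choose, Int.toNat_natCast]

end Choose

section Truncation

variable {M : Type*} [AddCommGroup M]

theorem LexTrunc.uniform {c : ℤ → ℤ → M} (hc : LexTrunc c) (K : ℤ) :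
    ∃ B : ℤ, ∀ a ≤ K, ∀ b < B, c a b = 0 := by
  obtain ⟨⟨A, hA⟩, h⟩ := hc
  choose B hB using h
  obtain ⟨L, hL⟩ := ((Set.finite_Icc A K).image B).bddBelow
  refine ⟨L, fun a ha b hb => ?_⟩
  rcases lt_or_ge a A with h | h
  · exact hA a h b
  · exact hB a b (hb.trans_le (hL ⟨a, ⟨h, ha⟩, rfl⟩))

theorem LowerTrunc2.lexTrunc {c : ℤ → ℤ → M} (hc : LowerTrunc2 c) : LexTrunc c := by
  obtain ⟨B, hB⟩ := hc
  exact ⟨⟨B, fun a ha b => hB a b (Or.inl ha)⟩, fun a => ⟨B, fun b hb => hB a b (Or.inr hb)⟩⟩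

theorem LowerTrunc2.flip {c : ℤ → ℤ → M} (hc : LowerTrunc2 c) :
    LowerTrunc2 fun m n => c n m := by
  obtain ⟨B, hB⟩ := hc
  exact ⟨B, fun m n h => hB n m h.symm⟩

theorem LexTrunc.sub {c d : ℤ → ℤ → M} (hc : LexTrunc c) (hd : LexTrunc d) :
    LexTrunc fun a b => c a b - d a b := by
  obtain ⟨⟨A, hA⟩, h⟩ := hc
  obtain ⟨⟨A', hA'⟩, h'⟩ := hd
  refine ⟨⟨min A A', fun a ha b => ?_⟩, fun a => ?_⟩
  · simp [hA a (by omega) b, hA' a (by omega) b]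
  · obtain ⟨B, hB⟩ := h a
    obtain ⟨B', hB'⟩ := h' a
    exact ⟨min B B', fun b hb => by simp [hB b (by omega), hB' b (by omega)]⟩

/-- A nonzero family that is truncated for the lexicographic order has a leading coefficient. -/
theorem LexTrunc.exists_leading {c : ℤ → ℤ → M} (hc : LexTrunc c) {a₁ b₁ : ℤ}
    (h : c a₁ b₁ ≠ 0) :
    ∃ a b, c a b ≠ 0 ∧ ∀ a' b', c a' b' ≠ 0 → a ≤ a' ∧ (a' = a → b ≤ b') := by
  obtain ⟨⟨A, hA⟩, hB⟩ := hc
  obtain ⟨a, ⟨b₂, hb₂⟩, ha⟩ := Int.exists_least_of_bdd (P := fun a => ∃ b, c a b ≠ 0)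
    ⟨A, fun z ⟨b, hb⟩ => not_lt.mp fun hz => hb (hA z hz b)⟩ ⟨a₁, b₁, h⟩
  obtain ⟨B, hB⟩ := hB a
  obtain ⟨b, hb, hb'⟩ := Int.exists_least_of_bdd (P := fun b => c a b ≠ 0)
    ⟨B, fun z hz => not_lt.mp fun hzB => hz (hB z hzB)⟩ ⟨b₂, hb₂⟩
  refine ⟨a, b, hb, fun a' b' h' => ⟨ha a' ⟨b', h'⟩, ?_⟩⟩
  rintro rfl
  exact hb' b' h'

theorem finite_setOf_ne_zero {f : ℤ → ℤ → ℂ} {c : ℤ → ℤ → M}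
    (hf : LexTrunc f) (hc : LexTrunc c) (m n : ℤ) :
    {p : ℤ × ℤ | f p.1 p.2 ≠ 0 ∧ c (m - p.1) (n - p.2) ≠ 0}.Finite := by
  obtain ⟨A, hA⟩ := hf.1
  obtain ⟨A', hA'⟩ := hc.1
  obtain ⟨B, hB⟩ := hf.uniform (m - A')
  obtain ⟨B', hB'⟩ := hc.uniform (m - A)
  refine ((Set.finite_Icc A (m - A')).prod (Set.finite_Icc B (n - B'))).subset ?_
  rintro ⟨i, j⟩ ⟨h1, h2⟩
  dsimp only at h1 h2
  have e1 : A ≤ i := not_lt.mp fun h => h1 (hA _ h _)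
  have e2 : A' ≤ m - i := not_lt.mp fun h => h2 (hA' _ h _)
  have e3 : B ≤ j := not_lt.mp fun h => h1 (hB _ (by omega) _ h)
  have e4 : B' ≤ n - j := not_lt.mp fun h => h2 (hB' _ (by omega) _ h)
  exact ⟨⟨e1, by dsimp only; omega⟩, ⟨e3, by dsimp only; omega⟩⟩

theorem finite_setOf_ne_zero₃ {f g : ℤ → ℤ → ℂ} {c : ℤ → ℤ → M}
    (hf : LexTrunc f) (hg : LexTrunc g) (hc : LexTrunc c) (m n : ℤ) :
    {x : (ℤ × ℤ) × ℤ × ℤ | f x.1.1 x.1.2 ≠ 0 ∧ g x.2.1 x.2.2 ≠ 0 ∧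
      c (m - x.1.1 - x.2.1) (n - x.1.2 - x.2.2) ≠ 0}.Finite := by
  obtain ⟨A, hA⟩ := hf.1
  obtain ⟨A', hA'⟩ := hg.1
  obtain ⟨A'', hA''⟩ := hc.1
  obtain ⟨B, hB⟩ := hf.uniform (m - A' - A'')
  obtain ⟨B', hB'⟩ := hg.uniform (m - A - A'')
  obtain ⟨B'', hB''⟩ := hc.uniform (m - A - A')
  refine (((Set.finite_Icc A (m - A' - A'')).prod (Set.finite_Icc B (n - B' - B''))).prod
    ((Set.finite_Icc A' (m - A - A'')).prod (Set.finite_Icc B' (n - B - B'')))).subset ?_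
  rintro ⟨⟨i, j⟩, k, l⟩ ⟨h1, h2, h3⟩
  dsimp only at h1 h2 h3
  have e1 : A ≤ i := not_lt.mp fun h => h1 (hA _ h _)
  have e2 : A' ≤ k := not_lt.mp fun h => h2 (hA' _ h _)
  have e3 : A'' ≤ m - i - k := not_lt.mp fun h => h3 (hA'' _ h _)
  have e4 : B ≤ j := not_lt.mp fun h => h1 (hB _ (by omega) _ h)
  have e5 : B' ≤ l := not_lt.mp fun h => h2 (hB' _ (by omega) _ h)
  have e6 : B'' ≤ n - j - l := not_lt.mp fun h => h3 (hB'' _ (by omega) _ h)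
  simp only [Set.mem_prod, Set.mem_Icc]
  omega

end Truncation

section SeriesMul

variable {M : Type*} [AddCommGroup M] [Module ℂ M]

theorem finite_support_smul {f : ℤ → ℤ → ℂ} {c : ℤ → ℤ → M}
    (hf : LexTrunc f) (hc : LexTrunc c) (m n : ℤ) :
    (Function.support fun p : ℤ × ℤ => f p.1 p.2 • c (m - p.1) (n - p.2)).Finite :=
  (finite_setOf_ne_zero hf hc m n).subset fun _ hp => smul_ne_zero_iff.mp hp

theorem exists_of_seriesMul_ne_zero {f : ℤ → ℤ → ℂ} {c : ℤ → ℤ → M} {m n : ℤ}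
    (h : seriesMul f c m n ≠ 0) :
    ∃ i j, f i j ≠ 0 ∧ c (m - i) (n - j) ≠ 0 := by
  by_contra! hzero
  refine h (finsum_eq_zero_of_forall_eq_zero fun p => ?_)
  by_contra hp
  obtain ⟨h1, h2⟩ := smul_ne_zero_iff.mp hp
  exact h2 (hzero _ _ h1)

theorem LexTrunc.seriesMul {f : ℤ → ℤ → ℂ} {c : ℤ → ℤ → M}
    (hf : LexTrunc f) (hc : LexTrunc c) : LexTrunc (seriesMul f c) := by
  obtain ⟨A, hA⟩ := hf.1
  obtain ⟨A', hA'⟩ := hc.1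
  refine ⟨⟨A + A', fun a ha b => ?_⟩, fun a => ?_⟩
  · by_contra h
    obtain ⟨i, j, h1, h2⟩ := exists_of_seriesMul_ne_zero h
    have e1 : A ≤ i := not_lt.mp fun h => h1 (hA _ h _)
    exact h2 (hA' _ (by omega) _)
  · obtain ⟨B, hB⟩ := hf.uniform (a - A')
    obtain ⟨B', hB'⟩ := hc.uniform (a - A)
    refine ⟨B + B', fun b hb => ?_⟩
    by_contra h
    obtain ⟨i, j, h1, h2⟩ := exists_of_seriesMul_ne_zero h
    have e1 : A ≤ i := not_lt.mp fun h => h1 (hA _ h _)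
    have e2 : A' ≤ a - i := not_lt.mp fun h => h2 (hA' _ h _)
    have e3 : B ≤ j := not_lt.mp fun h => h1 (hB _ (by omega) _ h)
    exact h2 (hB' _ (by omega) _ (by omega))

theorem seriesMul_comm (f g : ℤ → ℤ → ℂ) : seriesMul f g = seriesMul g f := by
  funext m n
  unfold seriesMul
  rw [← finsum_comp_equiv (Equiv.subLeft ((m, n) : ℤ × ℤ))]
  refine finsum_congr fun p => ?_
  simp [mul_comm]

theorem seriesMul_assoc_apply {f g : ℤ → ℤ → ℂ} {c : ℤ → ℤ → M} {m n : ℤ}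
    (hfin : {x : (ℤ × ℤ) × ℤ × ℤ | f x.1.1 x.1.2 ≠ 0 ∧ g x.2.1 x.2.2 ≠ 0 ∧
      c (m - x.1.1 - x.2.1) (n - x.1.2 - x.2.2) ≠ 0}.Finite) :
    seriesMul (seriesMul f g) c m n = seriesMul f (seriesMul g c) m n := by
  let F : (ℤ × ℤ) × ℤ × ℤ → M := fun x =>
    f x.1.1 x.1.2 • g x.2.1 x.2.2 • c (m - x.1.1 - x.2.1) (n - x.1.2 - x.2.2)
  have hF : F.support.Finite := hfin.subset fun x hx => by
    simpa only [F, Function.mem_support, smul_ne_zero_iff, Set.mem_ofPred_eq] using hx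
  let e : (ℤ × ℤ) × ℤ × ℤ ≃ (ℤ × ℤ) × ℤ × ℤ :=
    { toFun := fun x => (x.2, x.1 - x.2)
      invFun := fun x => (x.1 + x.2, x.1)
      left_inv := fun x => by simp
      right_inv := fun x => by simp }
  have hFe : (F ∘ e).support.Finite := by
    rw [Function.support_comp_eq_preimage]
    exact hF.preimage e.injective.injOn
  calc seriesMul (seriesMul f g) c m n = ∑ᶠ p, ∑ᶠ r, (F ∘ e) (p, r) := by
        refine finsum_congr fun p => ?_
        rw [seriesMul, finsum_smul]
        refine finsum_congr fun r => ?_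
        simp [F, e, mul_smul]
    _ = ∑ᶠ x, F x := by rw [← finsum_curry _ hFe]; exact finsum_comp_equiv e
    _ = seriesMul f (seriesMul g c) m n := by
        rw [finsum_curry _ hF]
        refine finsum_congr fun p => ?_
        rw [seriesMul, smul_finsum]

theorem seriesMul_assoc {f g : ℤ → ℤ → ℂ} {c : ℤ → ℤ → M}
    (hf : LexTrunc f) (hg : LexTrunc g) (hc : LexTrunc c) :
    seriesMul (seriesMul f g) c = seriesMul f (seriesMul g c) := by
  funext m n
  exact seriesMul_assoc_apply (finite_setOf_ne_zero₃ hf hg hc m n)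

theorem seriesMul_assoc_of_flip {f g : ℤ → ℤ → ℂ} {c : ℤ → ℤ → M}
    (hf : LexTrunc fun m n => f n m) (hg : LexTrunc fun m n => g n m)
    (hc : LexTrunc fun m n => c n m) :
    seriesMul (seriesMul f g) c = seriesMul f (seriesMul g c) := by
  funext m n
  refine seriesMul_assoc_apply ?_
  exact (finite_setOf_ne_zero₃ hf hg hc n m).preimage
    (f := Prod.map Prod.swap Prod.swap)
    (Prod.swap_injective.prodMap Prod.swap_injective).injOn

theorem seriesMul_left_comm {f g : ℤ → ℤ → ℂ} {c : ℤ → ℤ → M}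
    (hf : LexTrunc f) (hg : LexTrunc g) (hc : LexTrunc c) :
    seriesMul f (seriesMul g c) = seriesMul g (seriesMul f c) := by
  rw [← seriesMul_assoc hf hg hc, seriesMul_comm f g, seriesMul_assoc hg hf hc]

theorem seriesMul_left_comm_of_flip {f g : ℤ → ℤ → ℂ} {c : ℤ → ℤ → M}
    (hf : LexTrunc fun m n => f n m) (hg : LexTrunc fun m n => g n m)
    (hc : LexTrunc fun m n => c n m) :
    seriesMul f (seriesMul g c) = seriesMul g (seriesMul f c) := by
  rw [← seriesMul_assoc_of_flip hf hg hc, seriesMul_comm f g, seriesMul_assoc_of_flip hg hf hc]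

theorem eq_zero_of_seriesMul_eq_zero {f : ℤ → ℤ → ℂ} {c : ℤ → ℤ → M}
    (hf : LexTrunc f) (hc : LexTrunc c) {i j : ℤ} (hne : f i j ≠ 0)
    (h : ∀ m n, seriesMul f c m n = 0) (m n : ℤ) : c m n = 0 := by
  by_contra hmn
  obtain ⟨i₀, j₀, hf₀, hfmin⟩ := hf.exists_leading hne
  obtain ⟨m₀, n₀, hc₀, hcmin⟩ := hc.exists_leading hmn
  have key : seriesMul f c (i₀ + m₀) (j₀ + n₀) = f i₀ j₀ • c m₀ n₀ := by
    rw [seriesMul, finsum_eq_single _ (i₀, j₀)]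
    · simp
    · rintro ⟨k, l⟩ hkl
      by_contra hne'
      obtain ⟨h1, h2⟩ := smul_ne_zero_iff.mp hne'
      have e1 := hfmin _ _ h1
      have e2 := hcmin _ _ h2
      dsimp only at e1 e2
      have hk : k = i₀ := by omega
      have hl : l = j₀ := le_antisymm (by have := e2.2 (by omega); omega) (e1.2 hk)
      exact hkl (by rw [hk, hl])
  exact smul_ne_zero hf₀ hc₀ (key ▸ h _ _)

theorem seriesMul_left_cancel {f : ℤ → ℤ → ℂ} {c d : ℤ → ℤ → M}
    (hf : LexTrunc f) (hc : LexTrunc c) (hd : LexTrunc d) {i j : ℤ} (hne : f i j ≠ 0)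
    (h : seriesMul f c = seriesMul f d) : c = d := by
  funext m n
  refine sub_eq_zero.mp (eq_zero_of_seriesMul_eq_zero hf (hc.sub hd) hne (fun k l => ?_) m n)
  rw [seriesMul]
  simp only [smul_sub]
  rw [finsum_sub_distrib (finite_support_smul hf hc k l) (finite_support_smul hf hd k l)]
  exact sub_eq_zero.mpr (congrFun (congrFun h k) l)

theorem finsum_finsum_eq_seriesMul {f : ℤ → ℤ → ℂ} {c : ℤ → ℤ → M}
    (hf : LexTrunc f) (hc : LexTrunc c) (a b : ℤ) :
    ∑ᶠ i : ℤ, ∑ᶠ s : ℤ, f i s • c (a - i) (b - s) = seriesMul f c a b :=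
  (finsum_curry _ (finite_support_smul hf hc a b)).symm

end SeriesMul

section Subst

variable {M : Type*} [AddCommGroup M] [Module ℂ M]

theorem substSeries_eq (d : ℤ → ℤ → M) (i s : ℤ) :
    substSeries d i s = ∑ᶠ m : ℤ, intChoose m i • d m (s - m + i) := by
  unfold substSeries intChoose
  split_ifs <;> simp

theorem substScalar_eq_substSeries (f : ℤ → ℤ → ℂ) : substScalar f = substSeries f := rfl

theorem LowerTrunc2.lexTrunc_substSeries {d : ℤ → ℤ → M} (hd : LowerTrunc2 d) :
    LexTrunc (substSeries d) := by
  obtain ⟨B, hB⟩ := hd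
  refine ⟨⟨0, fun a ha b => by simp [substSeries, not_le.mpr ha]⟩,
    fun a => ⟨2 * B - a, fun b hb => ?_⟩⟩
  rw [substSeries_eq]
  refine finsum_eq_zero_of_forall_eq_zero fun m => ?_
  rw [hB _ _ (by omega), smul_zero]

/-- The substitution `x₁ = x₂ + x₀` is multiplicative. -/
theorem substSeries_seriesMul {f : ℤ → ℤ → ℂ} {d : ℤ → ℤ → M}
    (hf : LowerTrunc2 f) (hd : LowerTrunc2 d) :
    substSeries (seriesMul f d) = seriesMul (substSeries f) (substSeries d) := by
  funext a b
  let G : ℤ × (ℤ × ℤ) × ℤ → M := fun x =>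
    (intChoose x.2.1.1 x.2.2 * intChoose (x.1 - x.2.1.1) (a - x.2.2)) •
      f x.2.1.1 x.2.1.2 • d (x.1 - x.2.1.1) (b - x.1 + a - x.2.1.2)
  have hG : G.support.Finite := by
    obtain ⟨A, hA⟩ := hf
    obtain ⟨B, hB⟩ := hd
    refine ((Set.finite_Icc (A + B) (b + a - A - B)).prod
      (((Set.finite_Icc A (b + a - A - 2 * B)).prod
        (Set.finite_Icc A (b + a - A - 2 * B))).prod (Set.finite_Icc 0 a))).subset ?_
    rintro ⟨m, ⟨p, q⟩, i⟩ hx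
    simp only [G, Function.mem_support, smul_ne_zero_iff, mul_ne_zero_iff] at hx
    obtain ⟨⟨h1, h2⟩, h3, h4⟩ := hx
    have e1 := nonneg_of_intChoose_ne_zero h1
    have e2 := nonneg_of_intChoose_ne_zero h2
    have e3 := mt (hA p q) h3
    have e4 := mt (hB (m - p) (b - m + a - q)) h4
    simp only [Set.mem_prod, Set.mem_Icc]
    omega
  let e : (ℤ × ℤ) × ℤ × ℤ ≃ ℤ × (ℤ × ℤ) × ℤ :=
    { toFun := fun x => (x.2.1 + x.2.2, (x.2.1, x.1.2 - x.2.1 + x.1.1), x.1.1)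
      invFun := fun y => ((y.2.2, y.2.1.2 + y.2.1.1 - y.2.2), y.2.1.1, y.1 - y.2.1.1)
      left_inv := fun x => by ext <;> dsimp only <;> ring
      right_inv := fun y => by ext <;> dsimp only <;> ring }
  have hGe : (G ∘ e).support.Finite := by
    rw [Function.support_comp_eq_preimage]
    exact hG.preimage e.injective.injOn
  calc substSeries (seriesMul f d) a b
      = ∑ᶠ m, ∑ᶠ p, ∑ᶠ i, G (m, p, i) := by
        rw [substSeries_eq]
        refine finsum_congr fun m => ?_
        rw [seriesMul, smul_finsum]
        refine finsum_congr fun p => ?_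
        conv_lhs => rw [← add_sub_cancel p.1 m, intChoose_add, finsum_smul]
        simp [G]
    _ = ∑ᶠ x, G x := (finsum_curry₃ G hG).symm
    _ = ∑ᶠ p, ∑ᶠ m, ∑ᶠ n, (G ∘ e) (p, m, n) := by
        rw [← finsum_curry₃ _ hGe]
        exact (finsum_comp_equiv e).symm
    _ = seriesMul (substSeries f) (substSeries d) a b := by
        refine finsum_congr fun p => ?_
        rw [substSeries_eq, substSeries_eq, finsum_smul]
        refine finsum_congr fun m => ?_
        rw [smul_finsum]
        refine finsum_congr fun n => ?_
        have h1 : m + n - m = n := by ring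
        have h2 : b - (m + n) + a - (p.2 - m + p.1) = b - p.2 - n + (a - p.1) := by ring
        simp only [G, e, Function.comp_apply, Equiv.coe_fn_mk, h1, h2, smul_smul, smul_eq_mul]
        congr 1
        ring

theorem exists_substSeries_ne_zero {q : ℤ × ℤ →₀ ℂ} (hq : q ≠ 0)
    (hnonneg : ∀ p ∈ q.support, 0 ≤ p.1 ∧ 0 ≤ p.2) :
    ∃ i s, substSeries (fun m n => q (m, n)) i s ≠ 0 := by
  obtain ⟨⟨i, s⟩, hp, hmax⟩ :=
    q.support.exists_max_image Prod.fst (Finsupp.support_nonempty_iff.mpr hq)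
  refine ⟨i, s, ?_⟩
  rw [substSeries_eq, finsum_eq_single _ i]
  · rw [intChoose_self (hnonneg _ hp).1, one_smul, sub_add_cancel]
    exact Finsupp.mem_support_iff.mp hp
  · intro m hm
    by_contra h
    obtain ⟨h1, h2⟩ := smul_ne_zero_iff.mp h
    have hmem := Finsupp.mem_support_iff.mpr h2
    exact h1 (intChoose_of_lt (hnonneg _ hmem).1 (lt_of_le_of_ne (hmax _ hmem) hm))

end Subst

namespace QuasiMod

variable {V : Type*} [AddCommGroup V] [Module ℂ V] {VA : VertexAlg V}
  {W : Type*} [AddCommGroup W] [Module ℂ W] (QM : QuasiMod VA W)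

theorem YW_zero_left (w : W) (n : ℤ) : QM.YW 0 w n = 0 := by
  simpa using QM.smul_left 0 0 w n

theorem YW_zero_right (v : V) (n : ℤ) : QM.YW v 0 n = 0 := by
  simpa using QM.smul_right 0 v 0 n

/-- `Y_W(Y(u,x₀)v,x₂)w` lies in `W((x₂))((x₀))`. -/
theorem lexTrunc_iterate (u v : V) (w : W) :
    LexTrunc fun a b => QM.YW (VA.Y u v (-a - 1)) w (-b - 1) := by
  obtain ⟨N, hN⟩ := VA.trunc u v
  refine ⟨⟨-N, fun a ha b => ?_⟩, fun a => ?_⟩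
  · dsimp only
    rw [hN _ (by omega), QM.YW_zero_left]
  · obtain ⟨N', hN'⟩ := QM.trunc (VA.Y u v (-a - 1)) w
    exact ⟨-N', fun b hb => hN' _ (by omega)⟩

/-- `Y_W(u,x₁)Y_W(v,x₂)w` lies in `W((x₁))((x₂))`. -/
theorem lexTrunc_comp (u v : V) (w : W) :
    LexTrunc fun n m => QM.YW u (QM.YW v w (-n - 1)) (-m - 1) := by
  obtain ⟨N, hN⟩ := QM.trunc v w
  refine ⟨⟨-N, fun a ha b => ?_⟩, fun a => ?_⟩
  · dsimp only
    rw [hN _ (by omega), QM.YW_zero_right]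
  · obtain ⟨N', hN'⟩ := QM.trunc u (QM.YW v w (-a - 1))
    exact ⟨-N', fun b hb => hN' _ (by omega)⟩

end QuasiMod

/-- Let `V` be a vertex algebra, `W` a quasi `V`-module, and `u, v ∈ V`.  If
`h(x₁,x₂) ∈ ℂ((x₁,x₂))` is a formal series (given by its coefficients `hc`, lower
truncated in both variables) such that
`h(x₁,x₂) Y_W(u,x₁) Y_W(v,x₂) ∈ Hom(W, W((x₁,x₂)))`, then
`h(x₂+x₀,x₂) Y_W(Y(u,x₀)v,x₂) = (h(x₁,x₂) Y_W(u,x₁) Y_W(v,x₂))|_{x₁ = x₂+x₀}`,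
coefficientwise in `x₀^a x₂^b`. -/
theorem quasi_module_h_associativity
    {V : Type*} [AddCommGroup V] [Module ℂ V] (VA : VertexAlg V)
    {W : Type*} [AddCommGroup W] [Module ℂ W] (QM : QuasiMod VA W)
    (u v : V) (hc : ℤ → ℤ → ℂ) (hhc : LowerTrunc2 hc)
    (hreg : ∀ w : W, LowerTrunc2
      (seriesMul hc (fun m n => QM.YW u (QM.YW v w (-n - 1)) (-m - 1)))) :
    ∀ w : W, ∀ a b : ℤ,
      (∑ᶠ i : ℤ, ∑ᶠ s : ℤ, substScalar hc i s •
          QM.YW (VA.Y u v (-(a - i) - 1)) w (-(b - s) - 1)) =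
        substSeries
          (seriesMul hc (fun m n => QM.YW u (QM.YW v w (-n - 1)) (-m - 1))) a b := by
  intro w a b
  obtain ⟨q, hq0, hqnonneg, hqreg, hqassoc⟩ := QM.weak_assoc u v
  have hq : LowerTrunc2 fun m n => q (m, n) := by
    refine ⟨0, fun m n hmn => ?_⟩
    by_contra h
    have := hqnonneg _ (Finsupp.mem_support_iff.mpr h)
    dsimp only at this
    omega
  have hC := QM.lexTrunc_iterate (VA := VA) u v w
  have hF := QM.lexTrunc_comp u v w
  set C : ℤ → ℤ → W := fun a b => QM.YW (VA.Y u v (-a - 1)) w (-b - 1)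
  set F : ℤ → ℤ → W := fun m n => QM.YW u (QM.YW v w (-n - 1)) (-m - 1)
  set Q : ℤ → ℤ → ℂ := fun m n => q (m, n)
  have hQS := hq.lexTrunc_substSeries
  have hHS := hhc.lexTrunc_substSeries
  have hQC : seriesMul (substSeries Q) C = substSeries (seriesMul Q F) := by
    funext a b
    rw [← finsum_finsum_eq_seriesMul hQS hC]
    exact hqassoc w a b
  obtain ⟨i, s, hne⟩ := exists_substSeries_ne_zero hq0 hqnonneg
  have key : seriesMul (substSeries hc) C = substSeries (seriesMul hc F) := by
    refine seriesMul_left_cancel hQS (hHS.seriesMul hC) (hreg w).lexTrunc_substSeries hne ?_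
    rw [seriesMul_left_comm hQS hHS hC, hQC, ← substSeries_seriesMul hhc (hqreg w),
      ← substSeries_seriesMul hq (hreg w),
      seriesMul_left_comm_of_flip hhc.flip.lexTrunc hq.flip.lexTrunc hF]
  rw [substScalar_eq_substSeries, ← key]
  exact finsum_finsum_eq_seriesMul hHS hC a b
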